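/- arXiv:1007.0710 — 7 statements merged into one kernel-verified Lean document; each statement's English description precedes it below -/
import Mathlib

section
/- Let K be a finite abstract simplicial complex on a finite vertex set V, let R be a nontrivial commutative ring, let P be a finite set of colors and s ≥ 1 a natural number. A map f : V → P is a (P,s)-coloring of K if and only if the identity c(V) = ∏_{p ∈ P} c_{≤s}(f⁻¹(p)) holds in the Stanley–Reisner ring R[K]. -/
open MvPolynomial

/-- `K` is a (finite) abstract simplicial complex on the vertex set `V`:
a collection of subsets of `V` closed under taking subsets. -/
def IsASC {V : Type*} (K : Set (Finset V)) : Prop :=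
  ∀ σ ∈ K, ∀ τ ⊆ σ, τ ∈ K

/-- `f : V → P` is a `(P,s)`-coloring of `K`: every simplex contains at most `s`
vertices of any given color. -/
def IsColoring {V P : Type*} [DecidableEq P] (K : Set (Finset V)) (s : ℕ) (f : V → P) : Prop :=
  ∀ σ ∈ K, ∀ p : P, (σ.filter fun v => f v = p).card ≤ s

/-- The `s`-chromatic number of `K`: the least `r` such that `K` admits a coloring
from a palette of `r` colors. -/
noncomputable def chrom {V : Type*} (K : Set (Finset V)) (s : ℕ) : ℕ :=
  sInf {r : ℕ | ∃ f : V → Fin r, IsColoring K s f}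

/-- The Stanley–Reisner ideal of `K`: generated by the square-free monomials
`∏_{v ∈ τ} X v` over the non-faces `τ ∉ K`. -/
noncomputable def srIdeal (R : Type*) [CommRing R] {V : Type*} (K : Set (Finset V)) :
    Ideal (MvPolynomial V R) :=
  Ideal.span {m | ∃ τ : Finset V, τ ∉ K ∧ m = ∏ v ∈ τ, X v}

/-- `c_{≤s}(U) = Σ_{j=0}^{s} e_j(U)`: the sum of `1` and the first `s` elementary
symmetric polynomials in the variables of `U`. -/
noncomputable def cle (R : Type*) [CommRing R] {V : Type*} [DecidableEq V] (s : ℕ) (U : Finset V) :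
    MvPolynomial V R :=
  ∑ τ ∈ U.powerset.filter (fun τ => τ.card ≤ s), ∏ v ∈ τ, X v

theorem prod_cle_fibers (R : Type*) [CommRing R] {V P : Type*} [Fintype V] [DecidableEq V]
    [Fintype P] [DecidableEq P] (s : ℕ) (f : V → P) :
    ∏ p : P, cle R s (Finset.univ.filter fun v => f v = p) =
      ∑ τ : Finset V with ∀ p : P, (τ.filter fun v => f v = p).card ≤ s,
        ∏ v ∈ τ, (X v : MvPolynomial V R) := by
  simp only [cle]
  rw [Finset.prod_univ_sum]
  symm
  refine Finset.sum_bij' (fun τ _ p => τ.filter fun v => f v = p)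
    (fun g _ => Finset.univ.filter fun v => v ∈ g (f v)) ?_ ?_ ?_ ?_ ?_
  · intro τ hτ
    simp only [Finset.mem_filter, Finset.mem_univ, true_and] at hτ
    simp only [Fintype.mem_piFinset, Finset.mem_filter, Finset.mem_powerset]
    exact fun p => ⟨Finset.filter_subset_filter _ (Finset.subset_univ _), hτ p⟩
  · intro g hg
    simp only [Fintype.mem_piFinset, Finset.mem_filter, Finset.mem_powerset] at hg
    simp only [Finset.mem_filter, Finset.mem_univ, true_and]
    refine fun p => (Finset.card_le_card fun v hv => ?_).trans (hg p).2
    simp only [Finset.mem_filter, Finset.mem_univ, true_and] at hv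
    exact hv.2 ▸ hv.1
  · intro τ _
    ext v
    simp
  · intro g hg
    simp only [Fintype.mem_piFinset, Finset.mem_filter, Finset.mem_powerset] at hg
    funext p
    ext v
    simp only [Finset.mem_filter, Finset.mem_univ, true_and]
    refine ⟨fun h => h.2 ▸ h.1, fun h => ?_⟩
    have hv : f v = p := by simpa using (hg p).1 h
    exact ⟨hv.symm ▸ h, hv⟩
  · intro τ _
    exact (Finset.prod_fiberwise τ f _).symm

theorem prod_X_eq_monomial_indicator (R : Type*) [CommRing R] {V : Type*} (τ : Finset V) :
    ∏ v ∈ τ, (X v : MvPolynomial V R) = monomial (Finsupp.indicator τ fun _ _ => 1) 1 := by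
  classical
  have h : (Finsupp.indicator τ fun _ _ => 1) = ∑ v ∈ τ, Finsupp.single v 1 :=
    Finsupp.indicator_eq_sum_single τ fun _ => 1
  rw [h, monomial_sum_one]
  rfl

theorem indicator_one_le_indicator_one_iff {V : Type*} {τ σ : Finset V} :
    (Finsupp.indicator τ fun _ _ => 1 : V →₀ ℕ) ≤ Finsupp.indicator σ (fun _ _ => 1) ↔
      τ ⊆ σ := by
  classical
  simp only [Finsupp.le_def, Finsupp.indicator_apply, Finset.subset_iff]
  refine forall_congr' fun v => ?_
  by_cases h₁ : v ∈ τ <;> by_cases h₂ : v ∈ σ <;> simp [h₁, h₂]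

/-- A sum of distinct square-free monomials lies in the Stanley–Reisner ideal exactly when
all of them are supported on non-faces. -/
theorem sum_prod_X_mem_srIdeal_iff (R : Type*) [CommRing R] [Nontrivial R] {V : Type*}
    {K : Set (Finset V)} (hK : IsASC K) (A : Finset (Finset V)) :
    ∑ τ ∈ A, ∏ v ∈ τ, (X v : MvPolynomial V R) ∈ srIdeal R K ↔ ∀ τ ∈ A, τ ∉ K := by
  classical
  refine ⟨fun h σ hσ hσK => ?_, fun h => Ideal.sum_mem _ fun τ hτ =>
    Ideal.subset_span ⟨τ, h τ hτ, rfl⟩⟩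
  have hspan : srIdeal R K = Ideal.span ((fun d => monomial d (1 : R)) ''
      ((fun τ : Finset V => (Finsupp.indicator τ fun _ _ => 1 : V →₀ ℕ)) '' Kᶜ)) := by
    rw [srIdeal, Set.image_image]
    congr 1
    ext m
    simp [prod_X_eq_monomial_indicator, eq_comm]
  rw [hspan, mem_ideal_span_monomial_image] at h
  obtain ⟨_, ⟨τ, hτ, rfl⟩, hle⟩ := h (Finsupp.indicator σ fun _ _ => 1) (by
    have hcoeff (τ : Finset V) : coeff (Finsupp.indicator σ fun _ _ => 1)
        (∏ v ∈ τ, (X v : MvPolynomial V R)) = if τ = σ then 1 else 0 := by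
      rw [prod_X_eq_monomial_indicator, coeff_monomial]
      refine if_congr ⟨fun h => ?_, fun h => h ▸ rfl⟩ rfl rfl
      exact (indicator_one_le_indicator_one_iff.1 h.le).antisymm
        (indicator_one_le_indicator_one_iff.1 h.ge)
    simp [mem_support_iff, coeff_sum, hcoeff, hσ])
  exact hτ (hK σ hσK τ (indicator_one_le_indicator_one_iff.1 hle))

/-- `f : V → P` is a `(P,s)`-coloring of the abstract simplicial
complex `K` if and only if `c(V) = ∏_{p ∈ P} c_{≤s}(f⁻¹(p))` holds in the
Stanley–Reisner ring `R[K]`. -/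
theorem coloring_iff_sr_identity {V P : Type*} [Fintype V] [DecidableEq V]
    [Fintype P] [DecidableEq P] (R : Type*) [CommRing R] [Nontrivial R]
    (K : Set (Finset V)) (hK : IsASC K) (s : ℕ) (hs : 1 ≤ s) (f : V → P) :
    IsColoring K s f ↔
      Ideal.Quotient.mk (srIdeal R K) (∏ v : V, (1 + X v)) =
        ∏ p : P, Ideal.Quotient.mk (srIdeal R K)
          (cle R s (Finset.univ.filter fun v => f v = p)) := by
  have hdiff : ∏ v : V, (1 + X v) - ∏ p : P, cle R s (Finset.univ.filter fun v => f v = p) =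
      ∑ τ : Finset V with ¬ ∀ p : P, (τ.filter fun v => f v = p).card ≤ s,
        ∏ v ∈ τ, (X v : MvPolynomial V R) := by
    rw [prod_cle_fibers, Finset.prod_one_add, Finset.powerset_univ, sub_eq_iff_eq_add',
      Finset.sum_filter_add_sum_filter_not]
  rw [← map_prod, Ideal.Quotient.mk_eq_mk_iff_sub_mem, hdiff, sum_prod_X_mem_srIdeal_iff R hK]
  simp only [IsColoring, Finset.mem_filter, Finset.mem_univ, true_and]
  exact forall_congr' fun τ => by tauto
end

section
/- Let V and P be finite sets and R a nontrivial commutative ring. A map f : V → P is injective if and only if the identity ∏_{p ∈ P}(1 + Σ_{v ∈ f⁻¹(p)} v) = ∏_{v ∈ V}(1 + v) holds in the polynomial ring R[V]. -/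
open MvPolynomial

/-- A map `f : V → P` between finite sets is injective if and only if
`∏_{p ∈ P}(1 + Σ_{v ∈ f⁻¹(p)} v) = ∏_{v ∈ V}(1 + v)` holds in the polynomial ring
`R[V]`, for a nontrivial commutative ring `R`. -/
theorem injective_iff_chern_identity {V P : Type*} [Fintype V] [DecidableEq V]
    [Fintype P] [DecidableEq P] (R : Type*) [CommRing R] [Nontrivial R] (f : V → P) :
    Function.Injective f ↔
      ∏ p : P, (1 + ∑ v ∈ Finset.univ.filter fun v => f v = p, (X v : MvPolynomial V R)) =
        ∏ v : V, (1 + X v) := by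
  constructor
  · intro hf
    rw [← Finset.prod_fiberwise Finset.univ f]
    refine Finset.prod_congr rfl fun p _ => ?_
    by_cases hp : ∃ v, f v = p
    · obtain ⟨v, rfl⟩ := hp
      simp [hf.eq_iff, Finset.filter_eq']
    · push Not at hp
      simp [hp]
  · intro h a b hab
    by_contra hne
    -- Evaluate at `a ↦ 1`, `b ↦ -1`, and zero elsewhere: the two sides become `1` and `0`.
    have h' := congrArg (eval (fun v => (if v = a then 1 else 0) - if v = b then (1 : R) else 0)) h
    have hr : ∏ v : V, (1 + ((if v = a then 1 else 0) - if v = b then (1 : R) else 0)) = 0 :=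
      Finset.prod_eq_zero (Finset.mem_univ b) (by simp [Ne.symm hne])
    simp only [map_prod, map_add, map_one, map_sum, eval_X, hr] at h'
    simp [Finset.sum_sub_distrib, Finset.sum_ite_eq', hab] at h'
end

section
/- Let V and P be finite sets, R a nontrivial commutative ring, and s ≥ 1 a natural number. A map f : V → P satisfies |f⁻¹(p)| ≤ s for all p ∈ P (f is s-to-1) if and only if the identity c(V) = ∏_{p ∈ P} c_{≤s}(f⁻¹(p)) holds in the polynomial ring R[V]. -/
open MvPolynomial

theorem cle_eq_prod_one_add (R : Type*) [CommRing R] {V : Type*} [DecidableEq V] {s : ℕ}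
    {U : Finset V} (hU : U.card ≤ s) : cle R s U = ∏ v ∈ U, (1 + X v) := by
  rw [cle, Finset.prod_one_add, Finset.filter_true_of_mem]
  exact fun τ hτ => (Finset.card_le_card (Finset.mem_powerset.mp hτ)).trans hU

/-- Specializing every variable to a single one turns `c_{≤s}(U)` into a polynomial of degree at
most `min |U| s`. -/
theorem natDegree_aeval_cle_le (R : Type*) [CommRing R] {V : Type*} [DecidableEq V] (s : ℕ)
    (U : Finset V) :
    (aeval (fun _ : V => (Polynomial.X : Polynomial R)) (cle R s U)).natDegree ≤ min U.card s := by
  simp only [cle, map_sum, map_prod, aeval_X, Finset.prod_const]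
  refine Polynomial.natDegree_sum_le_of_forall_le _ _ fun τ hτ => ?_
  rw [Finset.mem_filter, Finset.mem_powerset] at hτ
  exact (Polynomial.natDegree_X_pow_le _).trans (le_min (Finset.card_le_card hτ.1) hτ.2)

/-- A map `f : V → P` between finite sets is `s`-to-1 (all fibers have
at most `s` elements) if and only if `c(V) = ∏_{p ∈ P} c_{≤s}(f⁻¹(p))` holds in the
polynomial ring `R[V]`, for a nontrivial commutative ring `R`. -/
theorem sToOne_iff_chern_identity {V P : Type*} [Fintype V] [DecidableEq V]
    [Fintype P] [DecidableEq P] (R : Type*) [CommRing R] [Nontrivial R]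
    (s : ℕ) (hs : 1 ≤ s) (f : V → P) :
    (∀ p : P, (Finset.univ.filter fun v => f v = p).card ≤ s) ↔
      (∏ v : V, (1 + X v) : MvPolynomial V R) =
        ∏ p : P, cle R s (Finset.univ.filter fun v => f v = p) := by
  constructor
  · intro h
    rw [Finset.prod_congr rfl fun p _ => cle_eq_prod_one_add R (h p)]
    exact (Finset.prod_fiberwise _ _ _).symm
  · intro h
    by_contra! ⟨p, hp⟩
    have hdeg := congrArg
      (fun q => (aeval (fun _ : V => (Polynomial.X : Polynomial R)) q).natDegree) h
    simp only [map_prod, map_add, map_one, aeval_X, Finset.prod_const] at hdeg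
    rw [add_comm, ← Polynomial.C_1, Polynomial.natDegree_pow_X_add_C] at hdeg
    have hle := (Polynomial.natDegree_prod_le Finset.univ _).trans
      (Finset.sum_le_sum fun p _ =>
        natDegree_aeval_cle_le R s (Finset.univ.filter fun v => f v = p))
    have hlt : ∑ p : P, min (Finset.univ.filter fun v => f v = p).card s <
        ∑ p : P, (Finset.univ.filter fun v => f v = p).card :=
      Finset.sum_lt_sum (fun _ _ => min_le_left _ _)
        ⟨p, Finset.mem_univ p, (min_le_right _ _).trans_lt hp⟩
    have hcard := Finset.card_eq_sum_card_fiberwise (f := f) (s := Finset.univ)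
      (t := Finset.univ) fun _ _ => Finset.mem_coe.mpr (Finset.mem_univ _)
    exact (hdeg.trans_le hle).not_gt (hlt.trans_eq hcard.symm)
end

section
/- Let K be a finite abstract simplicial complex on a finite vertex set V and R a commutative ring. In the polynomial ring R[V], the ideal generated by the square-free monomials ∏_{v ∈ τ} v over all non-faces τ ⊆ V, τ ∉ K (the Stanley–Reisner ideal), equals the intersection ⋂_{σ ∈ K} (V − σ) of the ideals generated by the sets of variables V − σ, where σ runs over the simplices of K. -/
open MvPolynomial

/-- A polynomial lies in the Stanley–Reisner ideal iff the support of each of its exponents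
contains a non-face. -/
theorem mem_srIdeal_iff {V R : Type*} [CommRing R] {K : Set (Finset V)}
    {p : MvPolynomial V R} :
    p ∈ srIdeal R K ↔ ∀ m ∈ p.support, ∃ τ : Finset V, τ ∉ K ∧ τ ⊆ m.support := by
  classical
  have hgen : {q : MvPolynomial V R | ∃ τ : Finset V, τ ∉ K ∧ q = ∏ v ∈ τ, X v} =
      (fun s => monomial s (1 : R)) ''
        ((fun τ : Finset V => ∑ v ∈ τ, Finsupp.single v 1) '' Kᶜ) := by
    ext q
    simp [monomial_sum_one, X, eq_comm]
  rw [srIdeal, hgen, mem_ideal_span_monomial_image]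
  refine forall₂_congr fun m _ => ?_
  simp only [Set.exists_mem_image, Set.mem_compl_iff]
  refine exists_congr fun τ => and_congr_right fun _ => ?_
  simp only [Finsupp.le_def, Finsupp.finsetSum_apply, Finsupp.single_apply,
    Finset.sum_ite_eq', Finset.subset_iff, Finsupp.mem_support_iff]
  refine forall_congr' fun v => ?_
  split_ifs with hv <;> simp [hv, Nat.one_le_iff_ne_zero]

/-- The Stanley–Reisner ideal of an abstract simplicial complex `K`
equals the intersection `⋂_{σ ∈ K} (V − σ)` of the ideals generated by the sets of
variables `V − σ`, where `σ` runs over the simplices of `K`. -/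
theorem srIdeal_eq_iInf {V : Type*} [Fintype V] [DecidableEq V]
    (R : Type*) [CommRing R] (K : Set (Finset V)) (hK : IsASC K) :
    srIdeal R K =
      ⨅ σ ∈ K, Ideal.span ((fun v => (X v : MvPolynomial V R)) '' {v : V | v ∉ σ}) := by
  ext p
  simp only [mem_srIdeal_iff, Ideal.mem_iInf, mem_ideal_span_X_image, Set.mem_ofPred_eq]
  constructor
  · intro h σ hσ m hm
    obtain ⟨τ, hτ, hτm⟩ := h m hm
    obtain ⟨v, hvτ, hvσ⟩ := Finset.not_subset.mp fun hle => hτ (hK σ hσ τ hle)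
    exact ⟨v, hvσ, Finsupp.mem_support_iff.mp (hτm hvτ)⟩
  · intro h m hm
    refine ⟨m.support, fun hmK => ?_, subset_rfl⟩
    obtain ⟨v, hv, hmv⟩ := h m.support hmK m hm
    exact hv (Finsupp.mem_support_iff.mpr hmv)
end

section
/- Let K be a finite abstract simplicial complex on a finite vertex set V and R a nontrivial commutative ring. A partition V = V_1 ∪ ⋯ ∪ V_r of V into r pairwise disjoint subsets is an r-coloring of K (i.e. every simplex of K contains at most one vertex from each V_j) if and only if the identity ∏_{v ∈ V}(1 + v) = ∏_{1 ≤ j ≤ r}(1 + Σ_{v ∈ V_j} v) holds in the Stanley–Reisner ring R[K]. -/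
open MvPolynomial

/-- If the values of `f` on `s` multiply pairwise to zero, then `∏ (1 + f v)` over `s` has no
terms beyond the linear ones. -/
theorem prod_one_add_eq_one_add_sum {V A : Type*} [CommRing A] (f : V → A) (s : Finset V)
    (h : ∀ u ∈ s, ∀ v ∈ s, u ≠ v → f u * f v = 0) :
    ∏ v ∈ s, (1 + f v) = 1 + ∑ v ∈ s, f v := by
  classical
  induction s using Finset.induction_on with
  | empty => simp
  | insert a s ha ih =>
    have hmul : f a * ∑ v ∈ s, f v = 0 := by
      rw [Finset.mul_sum]
      exact Finset.sum_eq_zero fun v hv =>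
        h a (Finset.mem_insert_self a s) v (Finset.mem_insert_of_mem hv)
          (ne_of_mem_of_not_mem hv ha).symm
    rw [Finset.prod_insert ha, Finset.sum_insert ha,
      ih fun u hu v hv => h u (Finset.mem_insert_of_mem hu) v (Finset.mem_insert_of_mem hv)]
    linear_combination hmul

/-- Evaluation at the indicator vector of a face kills the Stanley–Reisner ideal. -/
theorem eval_indicator_eq_zero_of_mem_srIdeal {V R : Type*} [DecidableEq V] [CommRing R]
    {K : Set (Finset V)} (hK : IsASC K) {σ : Finset V} (hσ : σ ∈ K)
    {p : MvPolynomial V R} (hp : p ∈ srIdeal R K) :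
    eval (fun w => if w ∈ σ then (1 : R) else 0) p = 0 := by
  suffices h : srIdeal R K ≤ RingHom.ker (eval fun w => if w ∈ σ then (1 : R) else 0) from h hp
  refine Ideal.span_le.2 ?_
  rintro _ ⟨τ, hτ, rfl⟩
  obtain ⟨w, hwτ, hwσ⟩ := Finset.not_subset.1 fun hsub => hτ (hK σ hσ τ hsub)
  simp only [SetLike.mem_coe, RingHom.mem_ker, map_prod, eval_X]
  exact Finset.prod_eq_zero hwτ (if_neg hwσ)

/-- A partition `V = V_1 ∪ ⋯ ∪ V_r` of the vertex set into `r`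
pairwise disjoint subsets is an `r`-coloring of `K` (each simplex meets each block in
at most one vertex) if and only if
`∏_{v ∈ V}(1+v) = ∏_{j=1}^{r}(1 + Σ_{v ∈ V_j} v)` holds in the Stanley–Reisner
ring `R[K]`. -/
theorem partition_coloring_iff_sr_identity {V : Type*} [Fintype V] [DecidableEq V]
    (R : Type*) [CommRing R] [Nontrivial R] (K : Set (Finset V)) (hK : IsASC K)
    (r : ℕ) (W : Fin r → Finset V)
    (hdisj : ∀ i j : Fin r, i ≠ j → Disjoint (W i) (W j))
    (hcover : ∀ v : V, ∃ i : Fin r, v ∈ W i) :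
    (∀ σ ∈ K, ∀ i : Fin r, (σ ∩ W i).card ≤ 1) ↔
      Ideal.Quotient.mk (srIdeal R K) (∏ v : V, (1 + X v)) =
        ∏ i : Fin r, Ideal.Quotient.mk (srIdeal R K) (1 + ∑ v ∈ W i, X v) := by
  have hprod (g : V → MvPolynomial V R) :
      ∏ v, g v = ∏ i, ∏ v ∈ W i, g v := by
    rw [← Finset.prod_biUnion fun i _ j _ hij => hdisj i j hij]
    congr 1
    ext v
    simpa using hcover v
  constructor
  · intro hcol
    rw [hprod, map_prod]
    refine Finset.prod_congr rfl fun i _ => ?_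
    simp only [map_prod, map_add, map_one, map_sum]
    refine prod_one_add_eq_one_add_sum _ _ fun u hu v hv huv => ?_
    rw [← map_mul, Ideal.Quotient.eq_zero_iff_mem]
    refine Ideal.subset_span ⟨{u, v}, fun hmem => ?_, (Finset.prod_pair huv).symm⟩
    have hcard := hcol _ hmem i
    rw [Finset.inter_eq_left.2 (by simp [Finset.insert_subset_iff, hu, hv]),
      Finset.card_pair huv] at hcard
    omega
  · intro hid σ hσ i
    by_contra! hcard
    obtain ⟨u, hu, v, hv, huv⟩ := Finset.one_lt_card.1 hcard
    rw [Finset.mem_inter] at hu hv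
    have hface : ({u, v} : Finset V) ∈ K :=
      hK σ hσ _ (by simp [Finset.insert_subset_iff, hu.1, hv.1])
    rw [← map_prod, Ideal.Quotient.eq] at hid
    have heval := eval_indicator_eq_zero_of_mem_srIdeal hK hface hid
    simp only [map_sub, map_prod, map_add, map_one, map_sum, eval_X] at heval
    have hleft : ∏ w, (1 + if w ∈ ({u, v} : Finset V) then (1 : R) else 0) = (1 + 1) * (1 + 1) := by
      rw [← Finset.prod_subset (Finset.subset_univ {u, v}) fun w _ hw => by rw [if_neg hw, add_zero],
        Finset.prod_pair huv]
      simp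
    have hright : ∏ j, (1 + ∑ w ∈ W j, if w ∈ ({u, v} : Finset V) then (1 : R) else 0) =
        1 + (1 + 1) := by
      rw [Fintype.prod_eq_single i]
      · rw [← Finset.sum_subset (s₁ := {u, v})
          (by simp [Finset.insert_subset_iff, hu.2, hv.2]) fun w _ hw => if_neg hw,
          Finset.sum_pair huv]
        simp
      · intro j hj
        rw [Finset.sum_eq_zero, add_zero]
        intro w hw
        refine if_neg fun hmem => ?_
        have hwi : w ∈ W i := by
          rcases Finset.mem_insert.1 hmem with rfl | hmem
          · exact hu.2
          · rw [Finset.mem_singleton.1 hmem]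
            exact hv.2
        exact Finset.disjoint_left.1 (hdisj j i hj) hw hwi
    rw [hleft, hright] at heval
    exact one_ne_zero (α := R) (by linear_combination heval)
end

section
/- For n ≥ 1 and m > 2n, the n-chromatic number of the cyclic polytope boundary complex CP(m,2n) is χ_n(CP(m,2n)) = 2 if m is even and χ_n(CP(m,2n)) = 3 if m is odd. -/
open MvPolynomial

/-- Gale's evenness condition: `σ` is a facet of the boundary complex of the cyclic
`n`-polytope on the ordered vertex set `Fin m` iff `|σ| = n` and between any two
vertices not in `σ` there is an even number of vertices of `σ`. -/
def GaleFacet (m n : ℕ) (σ : Finset (Fin m)) : Prop :=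
  σ.card = n ∧ ∀ i j : Fin m, i ∉ σ → j ∉ σ → i < j →
    Even (σ.filter fun k => i < k ∧ k < j).card

/-- The boundary complex `CP(m,n)` of the cyclic `n`-polytope on `m` vertices:
its simplices are the subsets of the facets given by Gale's evenness condition. -/
def CP (m n : ℕ) : Set (Finset (Fin m)) :=
  {τ | ∃ σ : Finset (Fin m), GaleFacet m n σ ∧ τ ⊆ σ}

/-- If the number of elements below a gap of `P` always has the same parity, then below an even
bound the even and the odd elements of `P` each make up at most half of the elements, rounded up. -/
theorem count_even_and_odd_le {P : ℕ → Prop} [DecidablePred P] {m k n : ℕ} (hkm : k ≤ m)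
    (hk : Even k) (hc : Nat.count P k ≤ 2 * n)
    (hP : ∀ i < m, ∀ j < m, ¬ P i → ¬ P j → Nat.count P i % 2 = Nat.count P j % 2) :
    Nat.count (fun x => P x ∧ x % 2 = 0) k ≤ n ∧ Nat.count (fun x => P x ∧ x % 2 = 1) k ≤ n := by
  have hsum : ∀ k, Nat.count P k =
      Nat.count (fun x => P x ∧ x % 2 = 0) k + Nat.count (fun x => P x ∧ x % 2 = 1) k := by
    intro k
    induction k with
    | zero => simp
    | succ k ih =>
      simp only [Nat.count_succ, ih]
      rcases Nat.mod_two_eq_zero_or_one k with h | h <;> by_cases hp : P k <;> simp [h, hp] <;> omega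
  rw [Nat.even_iff] at hk
  by_cases he : ∀ i < m, ¬ P i → Nat.count P i % 2 = 0
  · have key : ∀ k ≤ m, ∀ a b, a = Nat.count (fun x => P x ∧ x % 2 = 0) k →
        b = Nat.count (fun x => P x ∧ x % 2 = 1) k →
        ((a + b) % 2 = 0 → a = b) ∧ ((a + b) % 2 = 1 → k % 2 = 0 → b = a + 1) ∧
          ((a + b) % 2 = 1 → k % 2 = 1 → a = b + 1) := by
      intro k
      induction k with
      | zero => simp
      | succ k ih =>
        rintro hkm a b rfl rfl
        have ih := ih (by omega) _ _ rfl rfl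
        have h0 := he k (by omega)
        rw [hsum] at h0
        simp only [Nat.count_succ]
        rcases Nat.mod_two_eq_zero_or_one k with h | h <;> by_cases hp : P k <;>
          simp [h, hp] at h0 ⊢ <;> omega
    have := key k hkm _ _ rfl rfl
    have := hsum k
    omega
  · push Not at he
    obtain ⟨i, hi, hPi, hodd⟩ := he
    have key : ∀ k ≤ m, ∀ a b, a = Nat.count (fun x => P x ∧ x % 2 = 0) k →
        b = Nat.count (fun x => P x ∧ x % 2 = 1) k →
        ((a + b) % 2 = 1 → a = b + 1) ∧ ((a + b) % 2 = 0 → k % 2 = 0 → a = b) ∧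
          ((a + b) % 2 = 0 → k % 2 = 1 → a = b + 2) := by
      intro k
      induction k with
      | zero => simp
      | succ k ih =>
        rintro hkm a b rfl rfl
        have ih := ih (by omega) _ _ rfl rfl
        have h0 : ¬ P k → Nat.count P k % 2 = 1 := fun h => by
          have := hP k (by omega) i hi h hPi
          omega
        rw [hsum] at h0
        simp only [Nat.count_succ]
        rcases Nat.mod_two_eq_zero_or_one k with h | h <;> by_cases hp : P k <;>
          simp [h, hp] at h0 ⊢ <;> omega
    have := key k hkm _ _ rfl rfl
    have := hsum k
    omega

/-- A set satisfying Gale's evenness condition has the same parity of elements below any two of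
its gaps. -/
theorem GaleFacet.count_mod_two_eq {m n : ℕ} {σ : Finset (Fin m)} (h : GaleFacet m n σ) :
    ∀ i < m, ∀ j < m, i ∉ σ.map Fin.valEmbedding → j ∉ σ.map Fin.valEmbedding →
      Nat.count (· ∈ σ.map Fin.valEmbedding) i % 2 =
        Nat.count (· ∈ σ.map Fin.valEmbedding) j % 2 := by
  have main : ∀ i j, i < j → j < m → i ∉ σ.map Fin.valEmbedding → j ∉ σ.map Fin.valEmbedding →
      Nat.count (· ∈ σ.map Fin.valEmbedding) i % 2 =
        Nat.count (· ∈ σ.map Fin.valEmbedding) j % 2 := by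
    intro i j hij hj hi' hj'
    have hev := h.2 ⟨i, hij.trans hj⟩ ⟨j, hj⟩ (fun h => hi' (Finset.mem_map_of_mem Fin.valEmbedding h))
      (fun h => hj' (Finset.mem_map_of_mem Fin.valEmbedding h)) hij
    rw [← Finset.card_map Fin.valEmbedding] at hev
    simp only [Nat.count_eq_card_filter_range]
    have : (Finset.range j).filter (· ∈ σ.map Fin.valEmbedding) =
        (Finset.range i).filter (· ∈ σ.map Fin.valEmbedding) ∪
          (σ.filter fun k => (⟨i, hij.trans hj⟩ : Fin m) < k ∧ k < ⟨j, hj⟩).map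
            Fin.valEmbedding := by
      ext x
      simp only [Finset.mem_filter, Finset.mem_range, Finset.mem_union, Finset.mem_map,
        Fin.lt_def, Fin.valEmbedding_apply]
      constructor
      · rintro ⟨hx, y, hy, rfl⟩
        rcases lt_trichotomy (y : ℕ) i with h | h | h
        · exact .inl ⟨h, y, hy, rfl⟩
        · exact (hi' (Finset.mem_map.2 ⟨y, hy, h⟩)).elim
        · exact .inr ⟨y, ⟨hy, h, hx⟩, rfl⟩
      · rintro (⟨hx, y, hy, rfl⟩ | ⟨y, ⟨hy, h, hx⟩, rfl⟩)
        · exact ⟨hx.trans hij, y, hy, rfl⟩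
        · exact ⟨hx, y, hy, rfl⟩
    rw [this, Finset.card_union_of_disjoint]
    · rw [Nat.even_iff] at hev
      omega
    · rw [Finset.disjoint_left]
      simp only [Finset.mem_filter, Finset.mem_range, Finset.mem_map, Fin.lt_def,
        Fin.valEmbedding_apply]
      rintro x ⟨hx, -⟩ ⟨y, ⟨-, hy, -⟩, rfl⟩
      omega
  intro i hi j hj hi' hj'
  rcases lt_trichotomy i j with h | rfl | h
  · exact main i j h hj hi' hj'
  · rfl
  · exact (main j i h hi hj' hi').symm

/-- In a facet of `CP m (2 * n)`, at most `n` vertices below an even bound have a given parity. -/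
theorem GaleFacet.card_filter_parity_le {m n k : ℕ} {σ : Finset (Fin m)}
    (h : GaleFacet m (2 * n) σ) (hkm : k ≤ m) (hk : Even k) {c : ℕ} (hc : c < 2) :
    (σ.filter fun v : Fin m => (v : ℕ) < k ∧ (v : ℕ) % 2 = c).card ≤ n := by
  have hcount : Nat.count (· ∈ σ.map Fin.valEmbedding) k ≤ 2 * n := by
    rw [Nat.count_eq_card_filter_range, ← h.1, ← Finset.card_map Fin.valEmbedding]
    exact Finset.card_le_card fun x hx => (Finset.mem_filter.1 hx).2
  have key := count_even_and_odd_le hkm hk hcount h.count_mod_two_eq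
  have hle : (σ.filter fun v : Fin m => (v : ℕ) < k ∧ (v : ℕ) % 2 = c).card ≤
      Nat.count (fun x => x ∈ σ.map Fin.valEmbedding ∧ x % 2 = c) k := by
    rw [Nat.count_eq_card_filter_range, ← Finset.card_map Fin.valEmbedding]
    refine Finset.card_le_card fun x hx => ?_
    obtain ⟨y, hy, rfl⟩ := Finset.mem_map.1 hx
    obtain ⟨hy, hyk, hyc⟩ := Finset.mem_filter.1 hy
    exact Finset.mem_filter.2
      ⟨Finset.mem_range.2 hyk, Finset.mem_map_of_mem _ hy, hyc⟩
  interval_cases c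
  · exact hle.trans key.1
  · exact hle.trans key.2

/-- A map is a coloring of `CP m n` as soon as it is one on the facets. -/
theorem isColoring_CP_of_facets {m n s : ℕ} {P : Type*} [DecidableEq P] {f : Fin m → P}
    (h : ∀ σ, GaleFacet m n σ → ∀ p, (σ.filter fun v => f v = p).card ≤ s) :
    IsColoring (CP m n) s f := by
  rintro τ ⟨σ, hσ, hτ⟩ p
  exact (Finset.card_le_card (Finset.filter_subset_filter _ hτ)).trans (h σ hσ p)

theorem exists_isColoring_of_even {m n : ℕ} (hm : Even m) :
    ∃ f : Fin m → Fin 2, IsColoring (CP m (2 * n)) n f := by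
  refine ⟨fun v => ⟨(v : ℕ) % 2, Nat.mod_lt _ two_pos⟩, isColoring_CP_of_facets fun σ hσ p => ?_⟩
  refine (Finset.card_le_card ?_).trans (hσ.card_filter_parity_le le_rfl hm p.2)
  intro v hv
  simp only [Finset.mem_filter, Fin.ext_iff] at hv ⊢
  exact ⟨hv.1, v.2, hv.2⟩

theorem exists_isColoring_of_odd {m n : ℕ} (hn : 1 ≤ n) (hm : Odd m) :
    ∃ f : Fin m → Fin 3, IsColoring (CP m (2 * n)) n f := by
  refine ⟨fun v => if (v : ℕ) < m - 1 then ⟨(v : ℕ) % 2, by omega⟩ else 2,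
    isColoring_CP_of_facets fun σ hσ p => ?_⟩
  by_cases hp : (p : ℕ) < 2
  · refine (Finset.card_le_card ?_).trans
      (hσ.card_filter_parity_le (k := m - 1) (by omega) (by grind) hp)
    intro v hv
    simp only [Finset.mem_filter] at hv ⊢
    obtain ⟨hv, hvp⟩ := hv
    subst hvp
    split_ifs at hp ⊢ with h
    · exact ⟨hv, h, rfl⟩
    · simp at hp
  · refine le_trans (Finset.card_le_one.2 ?_) hn
    have aux : ∀ v : Fin m,
        (if (v : ℕ) < m - 1 then (⟨(v : ℕ) % 2, by omega⟩ : Fin 3) else 2) = p →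
          (v : ℕ) = m - 1 := by
      intro v hv
      split_ifs at hv with h
      · exact (hp (hv ▸ Nat.mod_lt _ two_pos)).elim
      · omega
    intro v hv w hw
    rw [Fin.ext_iff, aux v (Finset.mem_filter.1 hv).2, aux w (Finset.mem_filter.1 hw).2]

/-- The vertices outside the interval `[l, q)`, together with the pair `p, p + 1`, satisfy
Gale's evenness condition. -/
theorem galeFacet_attachFin {m n l q p : ℕ} {s : Finset ℕ} (hs : ∀ x ∈ s, x < m)
    (hmem : ∀ x < m, x ∈ s ↔ x < l ∨ q ≤ x ∨ x = p ∨ x = p + 1) (hcard : s.card = n) :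
    GaleFacet m n (s.attachFin hs) := by
  refine ⟨by simpa using hcard, fun i j hi hj hij => ?_⟩
  rw [Finset.mem_attachFin, hmem _ i.2] at hi
  rw [Finset.mem_attachFin, hmem _ j.2] at hj
  rw [Fin.lt_def] at hij
  rw [← Finset.card_map Fin.valEmbedding]
  have hmap : ((s.attachFin hs).filter fun k => i < k ∧ k < j).map Fin.valEmbedding =
      if (i : ℕ) < p ∧ p < j then {p, p + 1} else ∅ := by
    ext x
    simp only [Finset.mem_map, Finset.mem_filter, Finset.mem_attachFin, Fin.lt_def,
      Fin.valEmbedding_apply]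
    constructor
    · rintro ⟨y, ⟨hy, h1, h2⟩, rfl⟩
      rw [hmem _ y.2] at hy
      rw [if_pos (by omega)]
      simp only [Finset.mem_insert, Finset.mem_singleton]
      omega
    · intro hx
      split_ifs at hx with h
      · simp only [Finset.mem_insert, Finset.mem_singleton] at hx
        have := j.2
        exact ⟨⟨x, by omega⟩, ⟨(hmem x (by omega)).2 (by omega), by simp only; omega,
          by simp only; omega⟩, rfl⟩
      · simp at hx
  rw [hmap]
  split_ifs <;> simp

/-- In a coloring of `CP m (2 * n)` with at most two colors, each color occurs exactly `n` times
in every facet. -/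
theorem IsColoring.card_filter_eq {m n r : ℕ} (hr : r ≤ 2) {f : Fin m → Fin r}
    (hf : IsColoring (CP m (2 * n)) n f) {σ : Finset (Fin m)} (hσ : GaleFacet m (2 * n) σ)
    (p : Fin r) : (σ.filter fun v => f v = p).card = n := by
  have hsum := Finset.card_eq_sum_card_fiberwise (s := σ) (t := Finset.univ) (f := f)
    (fun _ _ => Finset.mem_coe.2 (Finset.mem_univ _))
  have hle := hf σ ⟨σ, hσ, subset_rfl⟩
  have h1 := hle p
  rw [← Finset.add_sum_erase _ _ (Finset.mem_univ p), hσ.1] at hsum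
  have h2 : ∑ b ∈ Finset.univ.erase p, (σ.filter fun v => f v = b).card ≤
      (Finset.univ.erase p).card * n := by
    exact Finset.sum_le_card_nsmul _ _ n fun b _ => hle b
  rw [Finset.card_erase_of_mem (Finset.mem_univ p), Finset.card_univ, Fintype.card_fin] at h2
  have h3 : (r - 1) * n ≤ 1 * n := Nat.mul_le_mul_right _ (by omega)
  omega

/-- In a coloring with at most two colors, exchanging one vertex of a facet for another preserves
the color. -/
theorem IsColoring.eq_of_exchange {m n r : ℕ} (hr : r ≤ 2) {f : Fin m → Fin r}
    (hf : IsColoring (CP m (2 * n)) n f) {s t : Finset ℕ} {hs : ∀ x ∈ s, x < m}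
    {ht : ∀ x ∈ t, x < m} (hσ : GaleFacet m (2 * n) (s.attachFin hs))
    (hτ : GaleFacet m (2 * n) (t.attachFin ht)) {a b : Fin m} (ha : (a : ℕ) ∈ s)
    (hb : (b : ℕ) ∈ t) (h : s.erase a = t.erase b) : f a = f b := by
  have hers : (s.attachFin hs).erase a = (t.attachFin ht).erase b := by
    ext x
    have := Finset.ext_iff.1 h x
    simpa [Fin.ext_iff] using this
  have h1 := hf.card_filter_eq hr hσ (f a)
  have h2 := hf.card_filter_eq hr hτ (f a)
  rw [← Finset.insert_erase (Finset.mem_attachFin hs |>.2 ha), Finset.filter_insert, if_pos rfl,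
    Finset.card_insert_of_notMem (by simp)] at h1
  rw [← Finset.insert_erase (Finset.mem_attachFin ht |>.2 hb), ← hers, Finset.filter_insert] at h2
  split_ifs at h2 with hab
  · exact hab.symm
  · omega

theorem IsColoring.eq_add_two {m n r : ℕ} (hn : 1 ≤ n) (hm : 2 * n < m) (hr : r ≤ 2)
    {f : Fin m → Fin r} (hf : IsColoring (CP m (2 * n)) n f) (i : ℕ) (hi : i + 2 < m) :
    f ⟨i, by omega⟩ = f ⟨i + 2, hi⟩ := by
  obtain ⟨l, q, hl, hq, hqm, hlq⟩ : ∃ l q, l ≤ i ∧ i + 3 ≤ q ∧ q ≤ m ∧ l + 2 + (m - q) = 2 * n := by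
    rcases le_total i (2 * n - 2) with h | h
    · exact ⟨i, i + m + 2 - 2 * n, by omega, by omega, by omega, by omega⟩
    · exact ⟨2 * n - 2, m, by omega, by omega, by omega, by omega⟩
  have hfacet : ∀ p, l ≤ p → p + 2 ≤ q → ∃ (hs : ∀ x ∈ Finset.range l ∪ Finset.Ico q m ∪ {p, p + 1},
      x < m), GaleFacet m (2 * n) (Finset.attachFin _ hs) := by
    intro p hp hpq
    have hs : ∀ x ∈ Finset.range l ∪ Finset.Ico q m ∪ {p, p + 1}, x < m := by
      intro x
      simp only [Finset.mem_union, Finset.mem_range, Finset.mem_Ico, Finset.mem_insert,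
        Finset.mem_singleton]
      omega
    refine ⟨hs, galeFacet_attachFin (l := l) (q := q) (p := p) hs ?_ ?_⟩
    · intro x hx
      simp only [Finset.mem_union, Finset.mem_range, Finset.mem_Ico, Finset.mem_insert,
        Finset.mem_singleton]
      omega
    · rw [Finset.card_union_of_disjoint, Finset.card_union_of_disjoint, Finset.card_range,
        Nat.card_Ico, Finset.card_pair (by omega)]
      · omega
      · rw [Finset.disjoint_left]
        simp only [Finset.mem_range, Finset.mem_Ico]
        omega
      · rw [Finset.disjoint_left]
        simp only [Finset.mem_union, Finset.mem_range, Finset.mem_Ico, Finset.mem_insert,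
          Finset.mem_singleton]
        omega
  obtain ⟨hs, hσ⟩ := hfacet i hl (by omega)
  obtain ⟨ht, hτ⟩ := hfacet (i + 1) (by omega) (by omega)
  refine hf.eq_of_exchange hr hσ hτ (by simp) (by simp) ?_
  ext x
  simp only [Finset.mem_erase, Finset.mem_union, Finset.mem_range, Finset.mem_Ico,
    Finset.mem_insert, Finset.mem_singleton]
  omega

theorem galeFacet_outside_interval {m n l : ℕ} (hm : n < m) (hl : l ≤ n) :
    ∃ (hs : ∀ x ∈ Finset.range l ∪ Finset.Ico (l + m - n) m, x < m),
      GaleFacet m n (Finset.attachFin _ hs) := by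
  have hs : ∀ x ∈ Finset.range l ∪ Finset.Ico (l + m - n) m, x < m := by
    intro x
    simp only [Finset.mem_union, Finset.mem_range, Finset.mem_Ico]
    omega
  refine ⟨hs, galeFacet_attachFin (l := l) (q := l + m - n) (p := m) hs ?_ ?_⟩
  · intro x hx
    simp only [Finset.mem_union, Finset.mem_range, Finset.mem_Ico]
    omega
  · rw [Finset.card_union_of_disjoint, Finset.card_range, Nat.card_Ico]
    · omega
    · rw [Finset.disjoint_left]
      simp only [Finset.mem_range, Finset.mem_Ico]
      omega

/-- For odd `m`, a coloring of `CP m (2 * n)` with at most two colors is constant. -/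
theorem IsColoring.eq_of_odd {m n r : ℕ} (hn : 1 ≤ n) (hm : 2 * n < m) (hodd : Odd m) (hr : r ≤ 2)
    {f : Fin m → Fin r} (hf : IsColoring (CP m (2 * n)) n f) (v : Fin m) :
    f v = f ⟨0, by omega⟩ := by
  have hstep := hf.eq_add_two hn hm hr
  have hpar : ∀ i (hi : i < m), f ⟨i, hi⟩ = f ⟨i % 2, by omega⟩ := by
    intro i
    induction i using Nat.strong_induction_on with
    | _ i ih =>
      intro hi
      rcases lt_or_ge i 2 with h | h
      · simp only [Nat.mod_eq_of_lt h]
      · obtain ⟨j, rfl⟩ := Nat.exists_eq_add_of_le' h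
        rw [← hstep j hi, ih j (by omega)]
        simp
  obtain ⟨hs, hσ⟩ := galeFacet_outside_interval hm (Nat.zero_le _)
  obtain ⟨ht, hτ⟩ := galeFacet_outside_interval (l := 1) hm (by omega)
  have hwrap : f ⟨m - 2 * n, by omega⟩ = f ⟨0, by omega⟩ := by
    refine hf.eq_of_exchange hr hσ hτ ?_ (by simp) ?_
    · simp only [Finset.mem_union, Finset.mem_range, Finset.mem_Ico]
      omega
    · ext x
      simp only [Finset.mem_erase, Finset.mem_union, Finset.mem_range, Finset.mem_Ico]
      omega
  have hmod : (m - 2 * n) % 2 = 1 := by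
    rw [Nat.odd_iff] at hodd
    omega
  rw [hpar] at hwrap
  simp only [hmod] at hwrap
  have := hpar v v.2
  rcases Nat.mod_two_eq_zero_or_one v with h | h <;> simp only [h] at this
  · exact this
  · exact this.trans hwrap

/-- A coloring of `CP m (2 * n)` is not constant. -/
theorem IsColoring.not_forall_eq {m n : ℕ} {P : Type*} [DecidableEq P] (hn : 1 ≤ n)
    (hm : 2 * n < m) {f : Fin m → P} (hf : IsColoring (CP m (2 * n)) n f) (p : P) :
    ¬ ∀ v, f v = p := by
  intro h
  obtain ⟨hs, hσ⟩ := galeFacet_outside_interval hm (Nat.zero_le _)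
  have := hf _ ⟨_, hσ, subset_rfl⟩ p
  rw [Finset.filter_true_of_mem fun v _ => h v, hσ.1] at this
  omega

/-- For `n ≥ 1` and `m > 2n`, the `n`-chromatic number of the cyclic
polytope boundary complex `CP(m,2n)` is `2` if `m` is even and `3` if `m` is odd. -/
theorem chrom_cyclic_even {n m : ℕ} (hn : 1 ≤ n) (hm : 2 * n < m) :
    chrom (CP m (2 * n)) n = if Even m then 2 else 3 := by
  split_ifs with hev
  · refine IsLeast.csInf_eq ⟨exists_isColoring_of_even hev, ?_⟩
    rintro r ⟨f, hf⟩
    by_contra! hr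
    have : Subsingleton (Fin r) := Fin.subsingleton_iff_le_one.2 (by omega)
    exact hf.not_forall_eq hn hm (f ⟨0, by omega⟩) fun v => Subsingleton.elim _ _
  · rw [Nat.not_even_iff_odd] at hev
    refine IsLeast.csInf_eq ⟨exists_isColoring_of_odd hn hev, ?_⟩
    rintro r ⟨f, hf⟩
    by_contra! hr
    exact hf.not_forall_eq hn hm _ (hf.eq_of_odd hn hm hev (by omega))
end

section
/- Let W be a finite set and ∂D[W] the boundary of the full simplex on W, i.e. the ASC of all proper subsets of W. For n ≥ 1: if |W| = 2n+1 then χ_n(∂D[W]) = 3; and if |W| = 2n+2 then χ_n(∂D[W]) = 4 when n = 1 and χ_n(∂D[W]) = 3 when n > 1. -/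
open MvPolynomial

lemma isColoring_boundary_iff {W P : Type*} [Fintype W] [DecidableEq P] {n : ℕ}
    (h : n + 1 < Fintype.card W) (f : W → P) :
    IsColoring ({σ : Finset W | σ ≠ Finset.univ} : Set (Finset W)) n f ↔
      ∀ p : P, (Finset.univ.filter fun v => f v = p).card ≤ n := by
  refine ⟨fun hf p => ?_, fun hf σ _ p =>
    (Finset.card_le_card (Finset.filter_subset_filter _ (Finset.subset_univ σ))).trans (hf p)⟩
  by_contra! hlt
  obtain ⟨t, ht, hcard⟩ := Finset.exists_subset_card_eq (Nat.succ_le_of_lt hlt)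
  have hne : t ≠ Finset.univ := by
    rintro rfl
    rw [Finset.card_univ] at hcard
    omega
  have hle := hf t hne p
  rw [Finset.filter_true_of_mem fun v hv => (Finset.mem_filter.mp (ht hv)).2] at hle
  omega

lemma exists_card_fiber_le_iff {W : Type*} [Fintype W] {n r : ℕ} :
    (∃ f : W → Fin r, ∀ p, (Finset.univ.filter fun v => f v = p).card ≤ n) ↔
      Fintype.card W ≤ r * n := by
  constructor
  · rintro ⟨f, hf⟩
    have := Finset.card_le_mul_card_image_of_maps_to (f := f) (s := Finset.univ)
      (t := Finset.univ) (fun _ _ => Finset.mem_univ _) n (fun p _ => hf p)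
    simpa [mul_comm] using this
  · intro hr
    let e := Fintype.equivFin W
    have hlt (v : W) : (e v : ℕ) / n < r :=
      Nat.div_lt_of_lt_mul ((e v).isLt.trans_le (by rwa [mul_comm]))
    refine ⟨fun v => ⟨(e v : ℕ) / n, hlt v⟩, fun p => ?_⟩
    have hcard : (Finset.Ico (p * n : ℕ) (p * n + n)).card = n := by simp
    refine (Finset.card_le_card_of_injOn (fun v => (e v : ℕ)) (fun v hv => ?_)
      fun v _ w _ hvw => e.injective (Fin.ext hvw)).trans_eq hcard
    have hp : (e v : ℕ) / n = p := by simpa [Fin.ext_iff] using hv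
    have hn : 0 < n := by
      rcases Nat.eq_zero_or_pos n with rfl | hn
      · exact absurd ((e v).isLt.trans_le hr) (by simp)
      · exact hn
    have hmod := Nat.mod_lt (e v : ℕ) hn
    have hdiv := Nat.div_add_mod' (e v : ℕ) n
    rw [hp] at hdiv
    simp only [Finset.coe_Ico, Set.mem_Ico]
    omega

lemma chrom_boundary_eq_succ {W : Type*} [Fintype W] {n r : ℕ}
    (h : n + 1 < Fintype.card W) (hlt : r * n < Fintype.card W)
    (hle : Fintype.card W ≤ (r + 1) * n) :
    chrom ({σ : Finset W | σ ≠ Finset.univ} : Set (Finset W)) n = r + 1 := by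
  simp only [chrom, isColoring_boundary_iff h, exists_card_fiber_le_iff]
  exact IsLeast.csInf_eq
    ⟨hle, fun k hk => Nat.succ_le_of_lt (lt_of_mul_lt_mul_right (hlt.trans_le hk) n.zero_le)⟩

/-- For the boundary `∂D[W]` of the full simplex on a finite set `W`
(the complex of all proper subsets of `W`) and `n ≥ 1`: if `|W| = 2n+1` then
`χ_n(∂D[W]) = 3`; if `|W| = 2n+2` then `χ_n(∂D[W]) = 4` when `n = 1` and
`χ_n(∂D[W]) = 3` when `n > 1`. -/
theorem chrom_boundary_simplex {W : Type*} [Fintype W] [DecidableEq W]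
    (n : ℕ) (hn : 1 ≤ n) :
    (Fintype.card W = 2 * n + 1 →
      chrom ({σ : Finset W | σ ≠ Finset.univ} : Set (Finset W)) n = 3) ∧
    (Fintype.card W = 2 * n + 2 →
      (n = 1 → chrom ({σ : Finset W | σ ≠ Finset.univ} : Set (Finset W)) n = 4) ∧
      (1 < n → chrom ({σ : Finset W | σ ≠ Finset.univ} : Set (Finset W)) n = 3)) := by
  refine ⟨fun h => ?_, fun h => ⟨fun hn1 => ?_, fun hn1 => ?_⟩⟩ <;>
    exact chrom_boundary_eq_succ (by omega) (by omega) (by omega)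
end
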